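/- arXiv:1810.10842 — 2 statements merged into one kernel-verified Lean document; each statement's English description precedes it below -/
import Mathlib

section
/- There exist absolute constants c > 0 and C > 0 such that for every finite set A ⊆ ℝ with |A| ≥ 2 and 0 ∉ A, the number of triples (α₁, α₂, α₃) ∈ (A/A)³ satisfying 1 − α₁ = α₂ − α₃ is at least c · |A|^15 / (|A+A|^12 · (log |A|)^C). -/
open Finset Pointwise

/-- The elements of `A` whose dilate by `l` is again in `A`. -/
noncomputable def dilateInter (A : Finset ℝ) (l : ℝ) : Finset ℝ :=
  A.filter fun a => l * a ∈ A

/-- The triples in `(A / A)³` solving `1 - x = y - z`. -/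
noncomputable def ratioSolutions (A : Finset ℝ) : Finset (ℝ × ℝ × ℝ) :=
  ((A / A) ×ˢ (A / A) ×ˢ (A / A)).filter fun t => 1 - t.1 = t.2.1 - t.2.2

lemma card_mul_sq_le_of_pos {A : Finset ℝ} (hA : ∀ a ∈ A, 0 < a) (t : ℕ) (L : Finset ℝ)
    (hL : ∀ l ∈ L, t ≤ (dilateInter A l).card) :
    L.card * t ^ 2 ≤ t ^ 2 +
      (((A + A) ×ˢ (A + A)).filter fun p => ∃ m ∈ L, p.2 < m * p.1).card := by
  induction L using Finset.induction_on_max with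
  | empty => simp
  | insert M L hM ih =>
    have ih' := ih fun l hl => hL l (mem_insert_of_mem hl)
    have hMn : M ∉ L := fun h => lt_irrefl _ (hM M h)
    rcases L.eq_empty_or_nonempty with rfl | hne
    · simp
    obtain ⟨m, hm, hmax⟩ := L.exists_max_image id hne
    simp only [id] at hmax
    have hmM := hM m hm
    set g : ℝ × ℝ → ℝ × ℝ := fun p => (p.1 + p.2, m * p.1 + M * p.2) with hg
    set I := ((dilateInter A m) ×ˢ (dilateInter A M)).image g with hI
    have hcard : t ^ 2 ≤ I.card := by
      rw [hI, card_image_of_injective, card_product, sq]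
      · exact Nat.mul_le_mul (hL m (mem_insert_of_mem hm)) (hL M (mem_insert_self _ _))
      · rintro ⟨a, b⟩ ⟨a', b'⟩ h
        simp only [hg, Prod.mk.injEq] at h
        obtain ⟨h1, h2⟩ := h
        have hb : (M - m) * (b - b') = 0 := by linear_combination h2 - m * h1
        have hb' : b = b' := by
          rcases mul_eq_zero.1 hb with h | h <;> linarith
        simp only [Prod.mk.injEq]
        exact ⟨by linarith, hb'⟩
    have hIsub : ∀ p ∈ I, p ∈ (A + A) ×ˢ (A + A) ∧ m * p.1 < p.2 ∧ p.2 < M * p.1 := by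
      intro p hp
      obtain ⟨⟨a, b⟩, hab, rfl⟩ := mem_image.1 hp
      simp only [dilateInter, mem_product, mem_filter] at hab
      obtain ⟨⟨ha, hma⟩, hb, hMb⟩ := hab
      have ha0 := hA a ha
      have hb0 := hA b hb
      refine ⟨mem_product.2 ⟨add_mem_add ha hb, add_mem_add hma hMb⟩, ?_, ?_⟩ <;>
        simp only [hg] <;> nlinarith
    set F := ((A + A) ×ˢ (A + A)).filter fun p => ∃ m ∈ L, p.2 < m * p.1 with hF
    have hdisj : Disjoint F I := by
      rw [Finset.disjoint_left]
      intro p hpF hpI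
      obtain ⟨hp, l, hl, hlt⟩ := mem_filter.1 hpF
      have hp0 : 0 < p.1 := by
        obtain ⟨a, ha, b, hb, hab⟩ := mem_add.1 (mem_product.1 hp).1
        rw [← hab]
        exact add_pos (hA a ha) (hA b hb)
      have := (hIsub p hpI).2.1
      have := mul_le_mul_of_nonneg_right (hmax l hl) hp0.le
      linarith
    have hsub : F ∪ I ⊆
        ((A + A) ×ˢ (A + A)).filter fun p => ∃ m ∈ insert M L, p.2 < m * p.1 := by
      intro p hp
      rcases mem_union.1 hp with h | h
      · obtain ⟨hp, l, hl, hlt⟩ := mem_filter.1 h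
        exact mem_filter.2 ⟨hp, l, mem_insert_of_mem hl, hlt⟩
      · exact mem_filter.2 ⟨(hIsub p h).1, M, mem_insert_self _ _, (hIsub p h).2.2⟩
    have hle := card_le_card hsub
    rw [card_union_of_disjoint hdisj] at hle
    rw [card_insert_of_notMem hMn, add_mul, one_mul]
    omega

lemma cube_le_sum_sq {n r : ℕ} (h : r ≤ n) :
    r ^ 3 ≤ ∑ t ∈ (Icc 1 n).filter (· ≤ r), 3 * t ^ 2 := by
  have hfil : (Icc 1 n).filter (· ≤ r) = Icc 1 r := by
    ext x
    simp only [mem_filter, mem_Icc]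
    omega
  rw [hfil]
  clear h hfil
  induction r with
  | zero => simp
  | succ k ih =>
    rw [sum_Icc_succ_top (by omega)]
    have : (k + 1) ^ 3 ≤ k ^ 3 + 3 * (k + 1) ^ 2 := by
      ring_nf
      omega
    omega

lemma card_le_card_add_self_of_nonempty (A : Finset ℝ) : A.card ≤ (A + A).card := by
  rcases A.eq_empty_or_nonempty with rfl | h
  · simp
  · exact card_le_card_add_right h

lemma sum_card_dilateInter_cube_le {A : Finset ℝ} (hA : ∀ a ∈ A, 0 < a) (L : Finset ℝ) :
    ∑ l ∈ L, (dilateInter A l).card ^ 3 ≤ 6 * A.card * (A + A).card ^ 2 := by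
  calc ∑ l ∈ L, (dilateInter A l).card ^ 3
      ≤ ∑ l ∈ L, ∑ t ∈ Icc 1 A.card,
          if t ≤ (dilateInter A l).card then 3 * t ^ 2 else 0 := by
        refine sum_le_sum fun l _ => ?_
        rw [← sum_filter]
        exact cube_le_sum_sq (card_filter_le _ _)
    _ = ∑ t ∈ Icc 1 A.card,
          (L.filter fun l => t ≤ (dilateInter A l).card).card * (3 * t ^ 2) := by
        rw [sum_comm]
        refine sum_congr rfl fun t _ => ?_
        rw [← sum_filter, sum_const, smul_eq_mul]
    _ ≤ ∑ _t ∈ Icc 1 A.card, 6 * (A + A).card ^ 2 := by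
        refine sum_le_sum fun t ht => ?_
        have h1 := card_mul_sq_le_of_pos hA t
          (L.filter fun l => t ≤ (dilateInter A l).card) fun l hl => (mem_filter.1 hl).2
        have h2 := h1.trans (Nat.add_le_add_left (card_filter_le _ _) _)
        rw [card_product] at h2
        have h3 : t ≤ (A + A).card :=
          (mem_Icc.1 ht).2.trans (card_le_card_add_self_of_nonempty A)
        have h4 : t ^ 2 ≤ (A + A).card ^ 2 := Nat.pow_le_pow_left h3 2
        nlinarith
    _ = 6 * A.card * (A + A).card ^ 2 := by
        rw [sum_const, Nat.card_Icc, smul_eq_mul, Nat.add_sub_cancel]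
        ring

lemma addEnergy_sq_le {A : Finset ℝ} (hA : ∀ a ∈ A, 0 < a) :
    A.addEnergy A ^ 2 ≤
      (ratioSolutions A).card * ∑ l ∈ A / A, (dilateInter A l).card ^ 3 := by
  set Q := ((A ×ˢ A) ×ˢ A ×ˢ A).filter fun x : (ℝ × ℝ) × ℝ × ℝ =>
    x.1.1 + x.2.1 = x.1.2 + x.2.2 with hQ
  set f : (ℝ × ℝ) × ℝ × ℝ → ℝ × ℝ × ℝ := fun x =>
    (x.1.2 / x.1.1, x.2.2 / x.1.1, x.2.1 / x.1.1) with hf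
  have hmem : ∀ x ∈ Q, (x.1.1 ∈ A ∧ x.1.2 ∈ A ∧ x.2.1 ∈ A ∧ x.2.2 ∈ A) ∧
      x.1.1 + x.2.1 = x.1.2 + x.2.2 := by
    intro x hx
    simp only [hQ, mem_filter, mem_product] at hx
    tauto
  have hmaps : ∀ x ∈ Q, f x ∈ ratioSolutions A := by
    intro x hx
    obtain ⟨⟨h1, h2, h3, h4⟩, h5⟩ := hmem x hx
    have h0 := (hA _ h1).ne'
    simp only [ratioSolutions, mem_filter, mem_product, hf]
    refine ⟨⟨div_mem_div h2 h1, div_mem_div h4 h1, div_mem_div h3 h1⟩, ?_⟩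
    field_simp
    linarith
  have hE : A.addEnergy A = ∑ t ∈ ratioSolutions A, (Q.filter fun x => f x = t).card :=
    card_eq_sum_card_fiberwise hmaps
  rw [hE]
  refine sq_sum_le_card_mul_sum_sq.trans (Nat.mul_le_mul_left _ ?_)
  have hl : ∑ t ∈ ratioSolutions A, (Q.filter fun x => f x = t).card ^ 2 =
      ((ratioSolutions A).sigma fun t =>
        (Q.filter fun x => f x = t) ×ˢ (Q.filter fun x => f x = t)).card := by
    simp [card_sigma, sq]
  have hr : ∑ l ∈ A / A, (dilateInter A l).card ^ 3 =
      ((A / A).sigma fun l =>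
        dilateInter A l ×ˢ dilateInter A l ×ˢ dilateInter A l).card := by
    simp [card_sigma, pow_succ, mul_assoc]
  rw [hl, hr]
  refine card_le_card_of_injOn
    (fun p => ⟨p.2.2.1.1 / p.2.1.1.1, p.2.1.1.1, p.2.1.1.2, p.2.1.2.2⟩) ?_ ?_
  · rintro ⟨t, x, y⟩ hp
    simp only [coe_sigma, Set.mem_sigma_iff, mem_coe, mem_product, mem_filter] at hp
    obtain ⟨-, ⟨hx, hxt⟩, hy, hyt⟩ := hp
    obtain ⟨⟨h1, h2, -, h4⟩, -⟩ := hmem x hx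
    obtain ⟨⟨k1, k2, -, k4⟩, -⟩ := hmem y hy
    have h0 := (hA _ h1).ne'
    have k0 := (hA _ k1).ne'
    have hxy := hxt.trans hyt.symm
    simp only [hf, Prod.mk.injEq] at hxy
    obtain ⟨e1, e2, -⟩ := hxy
    simp only [coe_sigma, Set.mem_sigma_iff, mem_coe, mem_product, dilateInter, mem_filter]
    refine ⟨div_mem_div k1 h1, ⟨h1, ?_⟩, ⟨h2, ?_⟩, h4, ?_⟩
    · rwa [div_mul_cancel₀ _ h0]
    · convert k2 using 1
      field_simp at e1 ⊢
      linarith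
    · convert k4 using 1
      field_simp at e2 ⊢
      linarith
  · rintro ⟨t, ⟨⟨d, a⟩, e, c⟩, ⟨d₁, a₁⟩, e₁, c₁⟩ hp
      ⟨s, ⟨⟨d', a'⟩, e', c'⟩, ⟨d₂, a₂⟩, e₂, c₂⟩ hq h
    simp only [coe_sigma, Set.mem_sigma_iff, mem_coe, mem_product, mem_filter] at hp hq
    obtain ⟨-, ⟨hx, hxt⟩, hy, hyt⟩ := hp
    obtain ⟨-, ⟨hz, hzt⟩, -, hwt⟩ := hq
    obtain ⟨⟨x1, -⟩, x5⟩ := hmem _ hx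
    obtain ⟨⟨y1, -⟩, -⟩ := hmem _ hy
    have z5 := (hmem _ hz).2
    simp only [Sigma.mk.injEq, heq_eq_eq, Prod.mk.injEq] at h
    obtain ⟨h0, rfl, rfl, rfl⟩ := h
    simp only at x1 x5 y1 z5 h0
    have hd := (hA _ x1).ne'
    have hd₁ := (hA _ y1).ne'
    obtain rfl : e = e' := by linarith
    obtain rfl : d₁ = d₂ := (div_left_inj' hd).1 h0
    subst hxt
    subst hzt
    have hyw := hyt.trans hwt.symm
    simp only [hf, Prod.mk.injEq, div_left_inj' hd₁] at hyw
    obtain ⟨rfl, rfl, rfl⟩ := hyw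
    rfl

lemma card_pow_le_of_pos {A : Finset ℝ} (hA : ∀ a ∈ A, 0 < a) (hne : A.Nonempty) :
    A.card ^ 7 ≤ 6 * (ratioSolutions A).card * (A + A).card ^ 4 := by
  have h1 := le_card_add_mul_addEnergy A A
  have h2 := (addEnergy_sq_le hA).trans
    (Nat.mul_le_mul_left _ (sum_card_dilateInter_cube_le hA (A / A)))
  have h3 := Nat.pow_le_pow_left h1 2
  refine Nat.le_of_mul_le_mul_left ?_ hne.card_pos
  calc A.card * A.card ^ 7 = (A.card ^ 2 * A.card ^ 2) ^ 2 := by ring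
    _ ≤ ((A + A).card * A.addEnergy A) ^ 2 := h3
    _ = (A + A).card ^ 2 * A.addEnergy A ^ 2 := by ring
    _ ≤ (A + A).card ^ 2 * ((ratioSolutions A).card * (6 * A.card * (A + A).card ^ 2)) :=
        Nat.mul_le_mul_left _ h2
    _ = _ := by ring

lemma ratioSolutions_mono {A B : Finset ℝ} (h : A ⊆ B) :
    ratioSolutions A ⊆ ratioSolutions B := by
  have := div_subset_div h h
  exact filter_subset_filter _ (product_subset_product this (product_subset_product this this))

lemma ratioSolutions_neg (A : Finset ℝ) : ratioSolutions (-A) = ratioSolutions A := by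
  have h : -A / -A = A / A := by
    ext x
    simp [mem_div, neg_div_neg_eq]
  simp only [ratioSolutions, h]

lemma card_pow_le {A : Finset ℝ} (h0 : (0 : ℝ) ∉ A) (hne : A.Nonempty) :
    A.card ^ 7 ≤ 768 * (ratioSolutions A).card * (A + A).card ^ 4 := by
  obtain ⟨B, hBpos, hBcard, hBT, hBS⟩ : ∃ B : Finset ℝ, (∀ b ∈ B, 0 < b) ∧
      A.card ≤ 2 * B.card ∧ (ratioSolutions B).card ≤ (ratioSolutions A).card ∧
      (B + B).card ≤ (A + A).card := by
    have hsplit : (A.filter (0 < ·)).card + (A.filter fun a => ¬ 0 < a).card = A.card :=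
      card_filter_add_card_filter_not _
    rcases le_total (A.filter fun a => ¬ 0 < a).card (A.filter (0 < ·)).card with h | h
    · exact ⟨A.filter (0 < ·), fun b hb => (mem_filter.1 hb).2, by omega,
        card_le_card (ratioSolutions_mono (filter_subset _ _)),
        card_le_card (add_subset_add (filter_subset _ _) (filter_subset _ _))⟩
    · refine ⟨-A.filter fun a => ¬ 0 < a, fun b hb => ?_, by rw [card_neg]; omega, ?_, ?_⟩
      · obtain ⟨hb, hb'⟩ := mem_filter.1 (mem_neg'.1 hb)
        have : -b ≠ 0 := fun h => h0 (h ▸ hb)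
        rcases lt_or_gt_of_ne this with h | h
        · linarith
        · exact absurd h hb'
      · rw [ratioSolutions_neg]
        exact card_le_card (ratioSolutions_mono (filter_subset _ _))
      · rw [← neg_add, card_neg]
        exact card_le_card (add_subset_add (filter_subset _ _) (filter_subset _ _))
  have hBne : B.Nonempty := card_pos.1 (by have := hne.card_pos; omega)
  calc A.card ^ 7 ≤ (2 * B.card) ^ 7 := Nat.pow_le_pow_left hBcard 7
    _ = 128 * B.card ^ 7 := by ring
    _ ≤ 128 * (6 * (ratioSolutions B).card * (B + B).card ^ 4) :=
        Nat.mul_le_mul_left _ (card_pow_le_of_pos hBpos hBne)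
    _ = 768 * (ratioSolutions B).card * (B + B).card ^ 4 := by ring
    _ ≤ _ := by gcongr

theorem stmt_9 :
    ∃ c C : ℝ, 0 < c ∧ 0 < C ∧ ∀ A : Finset ℝ,
      2 ≤ A.card → (0 : ℝ) ∉ A →
      c * (A.card : ℝ) ^ (15 : ℕ) /
          (((A + A).card : ℝ) ^ (12 : ℕ) * (Real.logb 2 (A.card : ℝ)) ^ C)
        ≤ ((((A / A) ×ˢ (A / A) ×ˢ (A / A)).filter fun t =>
            1 - t.1 = t.2.1 - t.2.2).card : ℝ) := by
  refine ⟨1 / 768, 1, by norm_num, one_pos, fun A hA h0 => ?_⟩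
  have hne : A.Nonempty := card_pos.1 (by omega)
  have hmain : (A.card : ℝ) ^ 7 ≤ 768 * (ratioSolutions A).card * ((A + A).card : ℝ) ^ 4 := by
    exact_mod_cast card_pow_le h0 hne
  have hS : (A.card : ℝ) ≤ (A + A).card := by
    exact_mod_cast card_le_card_add_self_of_nonempty A
  have hA2 : (2 : ℝ) ≤ A.card := by exact_mod_cast hA
  have hS0 : (0 : ℝ) < (A + A).card := by linarith
  have hlog : 1 ≤ Real.logb 2 (A.card : ℝ) := by
    rw [Real.le_logb_iff_rpow_le one_lt_two (by linarith)]
    simpa using hA2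
  change _ ≤ ((ratioSolutions A).card : ℝ)
  rw [Real.rpow_one, div_le_iff₀ (by positivity)]
  calc 1 / 768 * (A.card : ℝ) ^ 15 = 1 / 768 * (A.card : ℝ) ^ 7 * (A.card : ℝ) ^ 8 := by ring
    _ ≤ 1 / 768 * (768 * (ratioSolutions A).card * ((A + A).card : ℝ) ^ 4) *
          ((A + A).card : ℝ) ^ 8 := by gcongr
    _ = (ratioSolutions A).card * (((A + A).card : ℝ) ^ 12 * 1) := by ring
    _ ≤ _ := by gcongr
end

section
/- There exist absolute constants c > 0 and C > 0 such that for every finite set A ⊆ ℝ with |A| ≥ 2, writing S := A+A and assuming 0 ∉ S, the number of triples (x₁, x₂, x₃) ∈ (S/S)³ satisfying 1 − x₁ = x₂ − x₃ is at least c · |A|³ / (log |A|)^C. -/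
open Finset Pointwise

/-- Cauchy-Schwarz for the fibres of a map. -/
lemma card_sq_le_card_mul_card_collisions {α β : Type*} [DecidableEq β]
    (s : Finset α) (t : Finset β) (f : α → β) (hf : ∀ x ∈ s, f x ∈ t) :
    #s ^ 2 ≤ #t * #((s ×ˢ s).filter fun p => f p.1 = f p.2) := by
  have h2 : #((s ×ˢ s).filter fun p => f p.1 = f p.2)
      = ∑ b ∈ t, #(s.filter fun x => f x = b) ^ 2 := by
    rw [card_eq_sum_card_fiberwise (f := fun p => f p.1) (t := t)]
    · refine sum_congr rfl fun b _ => ?_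
      rw [sq, ← card_product]
      congr 1
      ext ⟨x, y⟩
      simp only [mem_filter, mem_product]
      grind
    · intro p hp
      simp only [coe_filter, mem_product, Set.mem_ofPred_eq] at hp
      exact hf _ hp.1.1
  rw [card_eq_sum_card_fiberwise hf, h2]
  exact sq_sum_le_card_mul_sum_sq

/-- The number of elements of `B` below `x`, divided by `m`: a partition of `B` into consecutive
blocks of at most `m` elements. -/
noncomputable def blockIndex (B : Finset ℝ) (m : ℕ) (x : ℝ) : ℕ :=
  #(B.filter fun y => y < x) / m

lemma blockIndex_mono (B : Finset ℝ) (m : ℕ) : Monotone (blockIndex B m) := by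
  intro x y hxy
  refine Nat.div_le_div_right (card_le_card fun z hz => ?_)
  rw [mem_filter] at hz ⊢
  exact ⟨hz.1, hz.2.trans_le hxy⟩

lemma blockIndex_le (B : Finset ℝ) (m : ℕ) (x : ℝ) : blockIndex B m x ≤ #B / m :=
  Nat.div_le_div_right (card_filter_le _ _)

lemma card_filter_blockIndex_eq_le (B : Finset ℝ) {m : ℕ} (hm : 0 < m) (j : ℕ) :
    #(B.filter fun x => blockIndex B m x = j) ≤ m := by
  have hmaps : ∀ x ∈ B.filter (fun x => blockIndex B m x = j),
      #(B.filter fun y => y < x) ∈ Finset.Ico (j * m) (j * m + m) := by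
    intro x hx
    have hj := (mem_filter.1 hx).2
    rw [blockIndex, Nat.div_eq_iff hm] at hj
    rw [Finset.mem_Ico]
    omega
  have hinj : Set.InjOn (fun x => #(B.filter fun y => y < x))
      (B.filter (fun x => blockIndex B m x = j) : Finset ℝ) := by
    have hlt : ∀ x ∈ B, ∀ z, x < z →
        #(B.filter fun y => y < x) < #(B.filter fun y => y < z) := by
      intro x hx z hxz
      refine card_lt_card ⟨fun y hy => ?_, fun h => ?_⟩
      · rw [mem_filter] at hy ⊢
        exact ⟨hy.1, hy.2.trans hxz⟩
      · exact lt_irrefl x (mem_filter.1 (h (mem_filter.2 ⟨hx, hxz⟩))).2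
    intro x hx z hz hxz
    have hxB := (mem_filter.1 (mem_coe.1 hx)).1
    have hzB := (mem_filter.1 (mem_coe.1 hz)).1
    rcases lt_trichotomy x z with h | h | h
    · exact absurd hxz (hlt x hxB z h).ne
    · exact h
    · exact absurd hxz (hlt z hzB x h).ne'
  simpa using card_le_card_of_injOn _ hmaps hinj

lemma card_pairs_blockIndex_le (B : Finset ℝ) {m : ℕ} (hm : 0 < m) :
    #((B ×ˢ B).filter fun p => blockIndex B m p.1 = blockIndex B m p.2) ≤ #B * m := by
  rw [card_eq_sum_card_fiberwise (f := Prod.fst) (t := B)]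
  · rw [← smul_eq_mul]
    refine sum_le_card_nsmul _ _ _ fun x _ => ?_
    refine le_trans ?_ (card_filter_blockIndex_eq_le B hm (blockIndex B m x))
    refine card_le_card_of_injOn Prod.snd ?_ ?_
    · rintro ⟨y, z⟩ h
      simp only [coe_filter, mem_filter, mem_product, Set.mem_ofPred_eq] at h ⊢
      grind
    · rintro ⟨y, z⟩ h ⟨y', z'⟩ h'
      simp only [coe_filter, mem_filter, mem_product, Set.mem_ofPred_eq] at h h'
      grind
  · intro p hp
    simp only [coe_filter, mem_product, Set.mem_ofPred_eq] at hp
    exact hp.1.1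

/-- The abscissae of the points of `B × B` on the line `y = g.1 * x + g.2`. -/
noncomputable def linePoints (B : Finset ℝ) (g : ℝ × ℝ) : Finset ℝ :=
  B.filter fun x => g.1 * x + g.2 ∈ B

/-- A line with nonzero slope crosses at most `2 * R + 1` cells of an `(R + 1) × (R + 1)` grid. -/
lemma sq_card_linePoints_le (B : Finset ℝ) (m : ℕ) (g : ℝ × ℝ) :
    #(linePoints B g) ^ 2 ≤ (2 * (#B / m) + 1) *
      #((linePoints B g ×ˢ linePoints B g).filter fun p =>
        blockIndex B m p.1 = blockIndex B m p.2 ∧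
        blockIndex B m (g.1 * p.1 + g.2) = blockIndex B m (g.1 * p.2 + g.2)) := by
  have key : ∃ f : ℝ → ℕ, (∀ x, f x ≤ 2 * (#B / m)) ∧ ∀ x y, f x = f y →
      blockIndex B m x = blockIndex B m y ∧
      blockIndex B m (g.1 * x + g.2) = blockIndex B m (g.1 * y + g.2) := by
    have hle := blockIndex_le B m
    have hmono := blockIndex_mono B m
    rcases le_total 0 g.1 with hg | hg
    · have hg' : ∀ x y, x ≤ y → blockIndex B m (g.1 * x + g.2) ≤ blockIndex B m (g.1 * y + g.2) :=
        fun x y h => hmono (by gcongr)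
      refine ⟨fun x => blockIndex B m x + blockIndex B m (g.1 * x + g.2), fun x => ?_,
        fun x y h => ?_⟩
      · have h1 := hle x
        have h2 := hle (g.1 * x + g.2)
        dsimp only
        omega
      · dsimp only at h
        rcases le_total x y with hxy | hxy <;>
        · have h1 := hmono hxy
          have h2 := hg' _ _ hxy
          omega
    · have hg' : ∀ x y, x ≤ y → blockIndex B m (g.1 * y + g.2) ≤ blockIndex B m (g.1 * x + g.2) :=
        fun x y h => hmono (by nlinarith)
      refine ⟨fun x => blockIndex B m x + (#B / m - blockIndex B m (g.1 * x + g.2)), fun x => ?_,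
        fun x y h => ?_⟩
      · have h1 := hle x
        dsimp only
        omega
      · dsimp only at h
        have h3 := hle (g.1 * x + g.2)
        have h4 := hle (g.1 * y + g.2)
        rcases le_total x y with hxy | hxy <;>
        · have h1 := hmono hxy
          have h2 := hg' _ _ hxy
          omega
  obtain ⟨f, hf, hf'⟩ := key
  have h := card_sq_le_card_mul_card_collisions (linePoints B g) (range (2 * (#B / m) + 1)) f
    fun x _ => mem_range.2 (Nat.lt_succ_of_le (hf x))
  rw [card_range] at h
  refine h.trans (Nat.mul_le_mul_left _ (card_le_card fun p hp => ?_))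
  rw [mem_filter] at hp ⊢
  exact ⟨hp.1, hf' _ _ hp.2⟩

lemma card_le_card_distinct_pairs_same_cell (B : Finset ℝ) {m k : ℕ} (g : ℝ × ℝ)
    (hk : k ≤ #(linePoints B g)) (hm : 2 * (2 * (#B / m) + 1) ≤ k) :
    k ≤ #((linePoints B g ×ˢ linePoints B g).filter fun p =>
        (blockIndex B m p.1 = blockIndex B m p.2 ∧
        blockIndex B m (g.1 * p.1 + g.2) = blockIndex B m (g.1 * p.2 + g.2)) ∧ p.1 ≠ p.2) := by
  have h1 := sq_card_linePoints_le B m g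
  set S := (linePoints B g ×ˢ linePoints B g).filter fun p =>
        blockIndex B m p.1 = blockIndex B m p.2 ∧
        blockIndex B m (g.1 * p.1 + g.2) = blockIndex B m (g.1 * p.2 + g.2) with hS
  have h2 : #(S.filter fun p => p.1 = p.2) ≤ #(linePoints B g) := by
    refine card_le_card_of_injOn Prod.fst ?_ ?_
    · intro p hp
      simp only [hS, coe_filter, mem_filter, mem_product, Set.mem_ofPred_eq] at hp
      exact hp.1.1.1
    · rintro ⟨y, z⟩ h ⟨y', z'⟩ h'
      simp only [coe_filter, Set.mem_ofPred_eq] at h h'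
      grind
  have h3 := card_filter_add_card_filter_not (s := S) fun p : ℝ × ℝ => p.1 = p.2
  have h4 : 2 * #(linePoints B g) ≤ #S := by
    rcases Nat.eq_zero_or_pos #(linePoints B g) with h0 | h0
    · omega
    · by_contra! hlt
      nlinarith
  rw [← filter_filter, ← hS]
  simp only [ne_eq]
  omega

/-- Szemerédi-Trotter bound for lines of nonzero slope that are rich in a Cartesian product. -/
lemma card_rich_lines_mul_le (B : Finset ℝ) (L : Finset (ℝ × ℝ)) {k : ℕ} (hk : 4 ≤ k)
    (hL : ∀ g ∈ L, k ≤ #(linePoints B g)) :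
    #L * k ^ 3 ≤ 81 * #B ^ 4 := by
  rcases L.eq_empty_or_nonempty with rfl | ⟨g₀, hg₀⟩
  · simp
  have hkB : k ≤ #B := (hL g₀ hg₀).trans (card_filter_le _ _)
  set m := 8 * #B / k + 1 with hm
  have hm0 : 0 < m := Nat.succ_pos _
  have hmk : m * k ≤ 9 * #B := by
    have := Nat.div_mul_le_self (8 * #B) k
    rw [hm, add_mul]
    omega
  have hmk' : 8 * #B < m * k := by
    rw [mul_comm m]
    exact Nat.lt_mul_div_succ _ (by omega)
  have hR : 8 * (#B / m) < k := by
    have := Nat.div_mul_le_self #B m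
    by_contra! h
    nlinarith
  have hcount : #L * k ≤ (#B * m) * (#B * m) := by
    have h1 : #L * k ≤ #(L.sigma fun g => (linePoints B g ×ˢ linePoints B g).filter fun p =>
        (blockIndex B m p.1 = blockIndex B m p.2 ∧
        blockIndex B m (g.1 * p.1 + g.2) = blockIndex B m (g.1 * p.2 + g.2)) ∧ p.1 ≠ p.2) := by
      rw [card_sigma, ← smul_eq_mul]
      exact card_nsmul_le_sum _ _ _ fun g hg =>
        card_le_card_distinct_pairs_same_cell B g (hL g hg) (by omega)
    refine h1.trans ?_
    refine le_trans ?_ (Nat.mul_le_mul (card_pairs_blockIndex_le B hm0)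
      (card_pairs_blockIndex_le B hm0))
    rw [← card_product]
    refine card_le_card_of_injOn
      (fun q => (q.2, (q.1.1 * q.2.1 + q.1.2, q.1.1 * q.2.2 + q.1.2))) ?_ ?_
    · rintro ⟨g, p⟩ h
      simp only [linePoints, coe_sigma, Set.mem_sigma_iff, mem_coe, mem_filter, mem_product] at h ⊢
      tauto
    · rintro ⟨⟨l, u⟩, x, y⟩ h ⟨⟨l', u'⟩, x', y'⟩ - heq
      simp only [Prod.mk.injEq] at heq
      obtain ⟨⟨rfl, rfl⟩, h1, h2⟩ := heq
      simp only [coe_sigma, Set.mem_sigma_iff, mem_coe, mem_filter, mem_product] at h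
      have hxy : x - y ≠ 0 := sub_ne_zero.2 h.2.2.2
      have hl : l = l' := mul_right_cancel₀ hxy (by linarith)
      subst hl
      have hu : u = u' := by linarith
      subst hu
      rfl
  calc #L * k ^ 3 = #L * k * k ^ 2 := by ring
    _ ≤ (#B * m) * (#B * m) * k ^ 2 := Nat.mul_le_mul_right _ hcount
    _ = #B ^ 2 * (m * k) ^ 2 := by ring
    _ ≤ #B ^ 2 * (9 * #B) ^ 2 := by gcongr
    _ = 81 * #B ^ 4 := by ring

lemma pow_four_le_sum_cubes (r : ℕ) : r ^ 4 ≤ ∑ j ∈ range r, 4 * (j + 1) ^ 3 := by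
  induction r with
  | zero => simp
  | succ n ih =>
    rw [sum_range_succ]
    calc (n + 1) ^ 4 ≤ (n + 1) ^ 4 + (6 * n ^ 2 + 8 * n + 3) := Nat.le_add_right _ _
      _ = n ^ 4 + 4 * (n + 1) ^ 3 := by ring
      _ ≤ _ := Nat.add_le_add_right ih _

lemma sum_card_linePoints_pow_four_le (B : Finset ℝ) (G : Finset (ℝ × ℝ)) (hG : #G ≤ #B ^ 4) :
    ∑ g ∈ G, #(linePoints B g) ^ 4 ≤ 324 * #B ^ 5 := by
  calc ∑ g ∈ G, #(linePoints B g) ^ 4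
      ≤ ∑ g ∈ G, ∑ j ∈ range #B, if j + 1 ≤ #(linePoints B g) then 4 * (j + 1) ^ 3 else 0 := by
        refine sum_le_sum fun g _ => (pow_four_le_sum_cubes _).trans ?_
        rw [← sum_filter]
        refine sum_le_sum_of_subset fun j hj => ?_
        have hB : #(linePoints B g) ≤ #B := card_filter_le _ _
        rw [mem_range] at hj
        rw [mem_filter, mem_range]
        omega
    _ = ∑ j ∈ range #B, #(G.filter fun g => j + 1 ≤ #(linePoints B g)) * (4 * (j + 1) ^ 3) := by
        rw [sum_comm]
        refine sum_congr rfl fun j _ => ?_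
        rw [← sum_filter, sum_const, smul_eq_mul]
    _ ≤ ∑ j ∈ range #B, 324 * #B ^ 4 := by
        refine sum_le_sum fun j _ => ?_
        rcases le_or_gt 4 (j + 1) with hj | hj
        · have := card_rich_lines_mul_le B (G.filter fun g => j + 1 ≤ #(linePoints B g)) hj
            fun g hg => (mem_filter.1 hg).2
          linarith
        · have h1 : #(G.filter fun g => j + 1 ≤ #(linePoints B g)) ≤ #B ^ 4 :=
            (card_filter_le _ _).trans hG
          have h2 : (j + 1) ^ 3 ≤ 3 ^ 3 := Nat.pow_le_pow_left (by omega) 3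
          calc _ ≤ #B ^ 4 * (4 * 3 ^ 3) := by gcongr
            _ ≤ 324 * #B ^ 4 := by omega
    _ = 324 * #B ^ 5 := by
        rw [sum_const, card_range, smul_eq_mul]
        ring

/-- The triple of ratios attached to a quadruple `(a, b, c, e)`; it determines the quadruple
`(-a, b, c, -e)` up to an affine map. -/
noncomputable def ratioTriple (t : ℝ × ℝ × ℝ × ℝ) : ℝ × ℝ × ℝ :=
  ((t.1 + t.2.1) / (t.1 + t.2.2.1), (t.2.2.1 + t.2.2.2) / (t.1 + t.2.2.1),
    (t.2.1 + t.2.2.2) / (t.1 + t.2.2.1))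

/-- The slope and intercept of the affine map sending `-a` to `-a'` and `c` to `c'`. -/
noncomputable def connectingLine (a c a' c' : ℝ) : ℝ × ℝ :=
  ((a' + c') / (a + c), c' - (a' + c') / (a + c) * c)

lemma connectingLine_apply {a b c e a' b' c' e' : ℝ} (h : a + c ≠ 0) (h' : a' + c' ≠ 0)
    (heq : ratioTriple (a, b, c, e) = ratioTriple (a', b', c', e')) :
    (connectingLine a c a' c').1 * a - (connectingLine a c a' c').2 = a' ∧
    (connectingLine a c a' c').1 * b + (connectingLine a c a' c').2 = b' ∧
    (connectingLine a c a' c').1 * c + (connectingLine a c a' c').2 = c' ∧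
    (connectingLine a c a' c').1 * e - (connectingLine a c a' c').2 = e' := by
  simp only [ratioTriple, Prod.mk.injEq] at heq
  obtain ⟨h1, h2, -⟩ := heq
  rw [div_eq_div_iff h h'] at h1 h2
  simp only [connectingLine]
  refine ⟨?_, ?_, ?_, ?_⟩ <;> field_simp <;> linarith

lemma card_ratioTriple_collisions_le (A : Finset ℝ) (h0 : (0 : ℝ) ∉ A + A) :
    #(((A ×ˢ A ×ˢ A ×ˢ A) ×ˢ (A ×ˢ A ×ˢ A ×ˢ A)).filter fun p =>
      ratioTriple p.1 = ratioTriple p.2) ≤ 324 * #A ^ 5 := by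
  classical
  have hne : ∀ a ∈ A, ∀ c ∈ A, a + c ≠ 0 := fun a ha c hc h => h0 (h ▸ add_mem_add ha hc)
  set G := (A ×ˢ A ×ˢ A ×ˢ A).image fun t => connectingLine t.1 t.2.1 t.2.2.1 t.2.2.2 with hGdef
  have hG : #G ≤ #A ^ 4 := by
    refine card_image_le.trans_eq ?_
    simp only [card_product]
    ring
  have hG' : #(G.image fun g => (g.1, -g.2)) ≤ #A ^ 4 := card_image_le.trans hG
  have hr := sum_card_linePoints_pow_four_le A G hG
  have hr' := sum_card_linePoints_pow_four_le A _ hG'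
  rw [sum_image (by rintro ⟨x, y⟩ - ⟨z, w⟩ - h; simpa using h)] at hr'
  have hcount : #(((A ×ˢ A ×ˢ A ×ˢ A) ×ˢ (A ×ˢ A ×ˢ A ×ˢ A)).filter fun p =>
      ratioTriple p.1 = ratioTriple p.2) ≤
      #(G.sigma fun g => (linePoints A g ×ˢ linePoints A g) ×ˢ
        (linePoints A (g.1, -g.2) ×ˢ linePoints A (g.1, -g.2))) := by
    refine card_le_card_of_injOn (fun p =>
      ⟨connectingLine p.1.1 p.1.2.2.1 p.2.1 p.2.2.2.1,
        ((p.1.2.1, p.1.2.2.1), (p.1.1, p.1.2.2.2))⟩) ?_ ?_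
    · rintro ⟨⟨a, b, c, e⟩, a', b', c', e'⟩ hp
      simp only [coe_filter, mem_product, Set.mem_ofPred_eq] at hp
      obtain ⟨⟨⟨ha, hb, hc, he⟩, ha', hb', hc', he'⟩, heq⟩ := hp
      obtain ⟨e1, e2, e3, e4⟩ := connectingLine_apply (hne a ha c hc) (hne a' ha' c' hc') heq
      simp only [linePoints, coe_sigma, Set.mem_sigma_iff, mem_coe, mem_product, mem_filter,
        ← sub_eq_add_neg, e1, e2, e3, e4]
      refine ⟨mem_image.2 ⟨(a, c, a', c'), ?_, rfl⟩, ?_⟩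
      · simp only [mem_product]
        tauto
      · tauto
    · rintro ⟨⟨a, b, c, e⟩, a', b', c', e'⟩ hp ⟨⟨x, y, z, w⟩, x', y', z', w'⟩ hq h
      simp only [coe_filter, mem_product, Set.mem_ofPred_eq] at hp hq
      obtain ⟨⟨⟨ha, hb, hc, he⟩, ha', hb', hc', he'⟩, heq⟩ := hp
      obtain ⟨⟨⟨hx, hy, hz, hw⟩, hx', hy', hz', hw'⟩, heq'⟩ := hq
      obtain ⟨e1, e2, e3, e4⟩ := connectingLine_apply (hne a ha c hc) (hne a' ha' c' hc') heq
      obtain ⟨f1, f2, f3, f4⟩ := connectingLine_apply (hne x hx z hz) (hne x' hx' z' hz') heq'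
      simp only [Sigma.mk.injEq, heq_eq_eq, Prod.mk.injEq] at h
      obtain ⟨hl, ⟨rfl, rfl⟩, rfl, rfl⟩ := h
      rw [← hl] at f1 f2 f3 f4
      simp only [Prod.mk.injEq, true_and]
      exact ⟨e1.symm.trans f1, e2.symm.trans f2, e3.symm.trans f3, e4.symm.trans f4⟩
  refine hcount.trans ?_
  rw [card_sigma]
  have hamgm : 2 * ∑ g ∈ G, #((linePoints A g ×ˢ linePoints A g) ×ˢ
        (linePoints A (g.1, -g.2) ×ˢ linePoints A (g.1, -g.2))) ≤
      ∑ g ∈ G, #(linePoints A g) ^ 4 + ∑ g ∈ G, #(linePoints A (g.1, -g.2)) ^ 4 := by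
    rw [mul_sum, ← sum_add_distrib]
    refine sum_le_sum fun g _ => ?_
    simp only [card_product]
    have := two_mul_le_add_sq (#(linePoints A g) ^ 2) (#(linePoints A (g.1, -g.2)) ^ 2)
    nlinarith
  linarith

theorem stmt_11 :
    ∃ c C : ℝ, 0 < c ∧ 0 < C ∧ ∀ A : Finset ℝ,
      2 ≤ A.card → (0 : ℝ) ∉ A + A →
      c * (A.card : ℝ) ^ (3 : ℕ) / (Real.logb 2 (A.card : ℝ)) ^ C
        ≤ (((((A + A) / (A + A)) ×ˢ ((A + A) / (A + A)) ×ˢ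
              ((A + A) / (A + A))).filter fun t =>
            1 - t.1 = t.2.1 - t.2.2).card : ℝ) := by
  refine ⟨1 / 324, 1, by norm_num, one_pos, fun A hA h0 => ?_⟩
  set T := (((A + A) / (A + A)) ×ˢ ((A + A) / (A + A)) ×ˢ ((A + A) / (A + A))).filter
    fun t => 1 - t.1 = t.2.1 - t.2.2 with hT
  have hmaps : ∀ t ∈ A ×ˢ A ×ˢ A ×ˢ A, ratioTriple t ∈ T := by
    rintro ⟨a, b, c, e⟩ h
    simp only [mem_product] at h
    obtain ⟨ha, hb, hc, he⟩ := h
    have hac : a + c ≠ 0 := fun h => h0 (h ▸ add_mem_add ha hc)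
    simp only [hT, ratioTriple, mem_filter, mem_product]
    refine ⟨⟨?_, ?_, ?_⟩, ?_⟩
    · exact div_mem_div (add_mem_add ha hb) (add_mem_add ha hc)
    · exact div_mem_div (add_mem_add hc he) (add_mem_add ha hc)
    · exact div_mem_div (add_mem_add hb he) (add_mem_add ha hc)
    · field_simp
      ring
  have hcs := (card_sq_le_card_mul_card_collisions _ T ratioTriple hmaps).trans
    (Nat.mul_le_mul_left _ (card_ratioTriple_collisions_le A h0))
  simp only [card_product] at hcs
  have hmain : #A ^ 3 ≤ 324 * #T := by
    have hpos : 0 < #A ^ 5 := by positivity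
    refine Nat.le_of_mul_le_mul_right ?_ hpos
    calc #A ^ 3 * #A ^ 5 = (#A * (#A * (#A * #A))) ^ 2 := by ring
      _ ≤ _ := hcs
      _ = _ := by ring
  have hmain' : (#A : ℝ) ^ 3 ≤ 324 * #T := by exact_mod_cast hmain
  have hlog : 1 ≤ Real.logb 2 (#A : ℝ) := by
    rw [Real.le_logb_iff_rpow_le (by norm_num) (by positivity), Real.rpow_one]
    exact_mod_cast hA
  rw [Real.rpow_one]
  refine (div_le_self (by positivity) hlog).trans ?_
  linarith
end
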